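/- For any finite non-degenerate network (V,K), any λ ∈ (0,∞), any admissible ν, and every t ∈ ℕ, the separation distance of the ARW(K,λ,ν) chain equals the tail of the IDLA filling time: d_sep(t) = P(T > t), where T is the filling time of the IDLA(K,ν) process. -/

import Mathlib

open scoped ENNReal BigOperators
open Filter Asymptotics

namespace ARW

variable {V : Type} [Fintype V] [DecidableEq V]

/-- A sub-stochastic matrix: every row sums to at most `1`. -/
def SubStochastic (K : V → V → ℝ≥0∞) : Prop := ∀ x, ∑ y, K x y ≤ 1

/-- Non-degenerate: no principal sub-matrix of `K` is stochastic. -/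
def NonDegenerate (K : V → V → ℝ≥0∞) : Prop :=
  ∀ S : Finset V, S.Nonempty → ∃ x ∈ S, ∑ y ∈ S, K x y ≠ 1

/-- A probability vector on `V`. -/
def IsProbVec (ν : V → ℝ≥0∞) : Prop := ∑ x, ν x = 1

/-- Probability that the `K`-walk currently at `x` next follows the trajectory `xs`
and is then killed. -/
noncomputable def pathProb (K : V → V → ℝ≥0∞) : V → List V → ℝ≥0∞
  | x, [] => 1 - ∑ y, K x y
  | x, y :: ys => K x y * pathProb K y ys

/-- Probability that a `(K,ν)`-walk has the (finite) full trajectory `w`. -/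
noncomputable def walkProb (K : V → V → ℝ≥0∞) (ν : V → ℝ≥0∞) : List V → ℝ≥0∞
  | [] => 0
  | x :: xs => ν x * pathProb K x xs

/-- `p(x)`: the probability that a `(K,ν)`-walk visits `x` before dying. -/
noncomputable def hitProb (K : V → V → ℝ≥0∞) (ν : V → ℝ≥0∞) (x : V) : ℝ≥0∞ :=
  ∑' w : List V, if x ∈ w then walkProb K ν w else 0

/-- The insertion law `ν` is admissible when every site has a chance of being
visited by a `(K,ν)`-walk. -/
def Admissible (K : V → V → ℝ≥0∞) (ν : V → ℝ≥0∞) : Prop := ∀ x, 0 < hitProb K ν x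

/-- The uniform law on `V`. -/
noncomputable def unifLaw (V : Type) [Fintype V] : V → ℝ≥0∞ :=
  fun _ => (Fintype.card V : ℝ≥0∞)⁻¹

/-! ### IDLA -/

/-- The IDLA update: the walker settles at the first site of its trajectory
which is not already occupied. -/
def idlaUpdate (S : Finset V) : List V → Finset V
  | [] => S
  | x :: xs => if x ∈ S then idlaUpdate S xs else insert x S

/-- The IDLA aggregate obtained from the initial set `A` after using the walks `ws`. -/
def idlaSet (A : Finset V) (ws : List (List V)) : Finset V := ws.foldl idlaUpdate A

/-- `P(T^A > t)`: probability that the IDLA process started from `A` and driven by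
i.i.d. `(K,ν)`-walks has not filled `V` after `t` steps. -/
noncomputable def idlaTail (K : V → V → ℝ≥0∞) (ν : V → ℝ≥0∞) (A : Finset V) (t : ℕ) : ℝ≥0∞ :=
  ∑' ws : Fin t → List V,
    (∏ i, walkProb K ν (ws i)) * (if idlaSet A (List.ofFn ws) = Finset.univ then 0 else 1)

/-- `E[T^A]`: the expected filling time of IDLA started from `A`. -/
noncomputable def idlaMean (K : V → V → ℝ≥0∞) (ν : V → ℝ≥0∞) (A : Finset V) : ℝ≥0∞ :=
  ∑' t : ℕ, idlaTail K ν A t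

/-- `Var(T^A)`: the variance of the filling time of IDLA started from `A`. -/
noncomputable def idlaVar (K : V → V → ℝ≥0∞) (ν : V → ℝ≥0∞) (A : Finset V) : ℝ≥0∞ :=
  (∑' t : ℕ, (2 * t + 1) * idlaTail K ν A t) - (idlaMean K ν A) ^ 2

/-! ### The ARW chain -/

/-- The state of a single site: empty, one sleeping particle, or `n+1` active particles. -/
inductive Site : Type
  | empty : Site
  | sleeping : Site
  | active (n : ℕ) : Site
deriving DecidableEq

/-- A configuration of particles. -/
abbrev Conf (V : Type) := V → Site

def Site.isActive : Site → Bool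
  | .active _ => true
  | _ => false

/-- The set of sites holding at least one active particle. -/
def activeSites (η : Conf V) : Finset V := Finset.univ.filter fun x => (η x).isActive

/-- Adding one active particle to a site (waking a sleeping particle if present). -/
def Site.addActive : Site → Site
  | .empty => .active 0
  | .sleeping => .active 1
  | .active n => .active (n + 1)

/-- Removing one active particle from a site. -/
def Site.removeOne : Site → Site
  | .active (n + 1) => .active n
  | _ => .empty

/-- Adding one active particle at site `y`. -/
def addActiveAt (η : Conf V) (y : V) : Conf V := Function.update η y (η y).addActive

/-- One sequential toppling step of ARW stabilization with sleep rate `lam`: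
an active site `x` is selected (if any); if its particle is alone it falls asleep
with probability `lam/(1+lam)`, moves to `y` with probability `K x y/(1+lam)` and
dies with the remaining probability; if it is not alone it moves to `y` with
probability `K x y` and dies with the remaining probability.  Stable
configurations are absorbing. -/
noncomputable def toppleKernel (K : V → V → ℝ≥0∞) (lam : ℝ) (η ξ : Conf V) : ℝ≥0∞ :=
  if h : (activeSites η).Nonempty then
    let x := h.choose
    let ημ : Conf V := Function.update η x (η x).removeOne
    let move : ℝ≥0∞ := ∑ y, if ξ = addActiveAt ημ y then K x y else 0
    let die : ℝ≥0∞ := if ξ = ημ then 1 - ∑ y, K x y else 0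
    if η x = Site.active 0 then
      ((if ξ = Function.update η x Site.sleeping then ENNReal.ofReal lam else 0) + move + die)
        / (ENNReal.ofReal lam + 1)
    else move + die
  else if ξ = η then 1 else 0

/-- Iterates of a sub-probability kernel on configurations. -/
noncomputable def kernelPow (M : Conf V → Conf V → ℝ≥0∞) : ℕ → Conf V → Conf V → ℝ≥0∞
  | 0 => fun η ξ => if ξ = η then 1 else 0
  | t + 1 => fun η ξ => ∑' σ : Conf V, M η σ * kernelPow M t σ ξ

/-- A stable configuration, seen as a configuration (`true` = sleeping particle). -/
def embed (b : V → Bool) : Conf V := fun x => if b x then Site.sleeping else Site.empty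

/-- One step of the `ARW(K,lam,ν)` chain: insert an active particle at a `ν`-distributed
site and stabilize; `arwStep K lam ν η ξ` is the probability of reaching the stable
configuration `ξ` from the stable configuration `η`. -/
noncomputable def arwStep (K : V → V → ℝ≥0∞) (lam : ℝ) (ν : V → ℝ≥0∞)
    (η ξ : V → Bool) : ℝ≥0∞ :=
  ∑ x, ν x * ⨆ t, kernelPow (toppleKernel K lam) t (addActiveAt (embed η) x) (embed ξ)

/-- The transition matrix of the `ARW(K,lam,ν)` chain on stable configurations. -/
noncomputable def arwMatrix (K : V → V → ℝ≥0∞) (lam : ℝ) (ν : V → ℝ≥0∞) :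
    Matrix (V → Bool) (V → Bool) ℝ :=
  Matrix.of fun η ξ => (arwStep K lam ν η ξ).toReal

/-! ### Distances to equilibrium, mixing and relaxation times -/

variable {S : Type} [Fintype S] [DecidableEq S]

/-- `π` is a stationary probability distribution for `P`. -/
def IsStationary (P : Matrix S S ℝ) (π : S → ℝ) : Prop :=
  (∀ s, 0 ≤ π s) ∧ (∑ s, π s = 1) ∧ ∀ s, ∑ r, π r * P r s = π s

/-- The separation distance to equilibrium at time `t`. -/
noncomputable def sepDist (P : Matrix S S ℝ) (π : S → ℝ) (t : ℕ) : ℝ :=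
  ⨆ η, ⨆ ξ, (1 - (P ^ t) η ξ / π ξ)

/-- The separation mixing time with precision `ε`. -/
noncomputable def sepMix (P : Matrix S S ℝ) (π : S → ℝ) (ε : ℝ) : ℕ :=
  sInf {t : ℕ | sepDist P π t ≤ ε}

/-- The total-variation distance to equilibrium at time `t`. -/
noncomputable def tvDist (P : Matrix S S ℝ) (π : S → ℝ) (t : ℕ) : ℝ :=
  ⨆ η, ⨆ A : Finset S, |∑ ξ ∈ A, ((P ^ t) η ξ - π ξ)|

/-- The total-variation mixing time with precision `ε`. -/
noncomputable def tvMix (P : Matrix S S ℝ) (π : S → ℝ) (ε : ℝ) : ℕ :=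
  sInf {t : ℕ | tvDist P π t ≤ ε}

/-- The relaxation time `1/(1-ρ)`, where `ρ` is the largest modulus of the
(complex) eigenvalues of `P` other than `1`. -/
noncomputable def relTime (P : Matrix S S ℝ) : ℝ :=
  (1 - sSup {r : ℝ | ∃ z : ℂ,
      z ≠ 1 ∧ (P.map (fun a : ℝ => (a : ℂ))).charpoly.IsRoot z ∧ r = ‖z‖})⁻¹

/-- Separation (or total-variation) cutoff for a sequence of chains with distance
functions `d n` and mixing times `ts n`. -/
def HasCutoff (d : ℕ → ℕ → ℝ) (ts : ℕ → ℕ) : Prop :=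
  ∀ α : ℝ, 0 ≤ α →
    (α < 1 → Tendsto (fun n => d n ⌊α * (ts n : ℝ)⌋₊) atTop (nhds 1)) ∧
    (1 < α → Tendsto (fun n => d n ⌊α * (ts n : ℝ)⌋₊) atTop (nhds 0))

end ARW
namespace ARW

set_option linter.unusedSectionVars false

section Aux
variable {V : Type} [Fintype V] [DecidableEq V]

def Site.slp : Site → Site
  | .active 0 => .sleeping
  | s => s

def opAt (u : Site → Site) (η : Conf V) (z : V) : Conf V := Function.update η z (u (η z))

abbrev remAt (η : Conf V) (z : V) : Conf V := opAt Site.removeOne η z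
abbrev slpAt (η : Conf V) (z : V) : Conf V := opAt Site.slp η z
abbrev addAt (η : Conf V) (z : V) : Conf V := opAt Site.addActive η z

def act (z : V) : Option (Option V) → Conf V → Conf V
  | none, η => slpAt η z
  | some none, η => remAt η z
  | some (some y), η => addAt (remAt η z) y

def Act (η : Conf V) (z : V) : Prop := ∃ n, η z = Site.active n

theorem opAt_comm (u v : Site → Site) (η : Conf V) (z w : V)
    (h : z = w → u (v (η z)) = v (u (η z))) :
    opAt u (opAt v η w) z = opAt v (opAt u η z) w := by
  by_cases hzw : z = w
  · subst hzw
    simp [opAt, h rfl]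
  · unfold opAt
    rw [Function.update_of_ne hzw, Function.update_of_ne (Ne.symm hzw), Function.update_comm]
    exact Ne.symm hzw

theorem Act.opAt_ne {η : Conf V} {z w : V} (h : Act η w) (hzw : z ≠ w) (u : Site → Site) :
    Act (opAt u η z) w := by
  obtain ⟨n, hn⟩ := h
  exact ⟨n, by rw [opAt, Function.update_of_ne hzw.symm, hn]⟩

theorem act_add_self (η : Conf V) (w : V) : Act (addAt η w) w := by
  unfold Act addAt opAt
  rw [Function.update_self]
  cases η w with
  | empty => exact ⟨0, rfl⟩
  | sleeping => exact ⟨1, rfl⟩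
  | active n => exact ⟨n+1, rfl⟩

theorem Act.add {η : Conf V} {w : V} (h : Act η w) (y : V) : Act (addAt η y) w := by
  by_cases hy : y = w
  · subst hy; exact act_add_self η y
  · exact h.opAt_ne hy _

theorem Act.act_ne {η : Conf V} {z w : V} (h : Act η w) (hzw : z ≠ w) (i : Option (Option V)) :
    Act (act z i η) w := by
  rcases i with _ | _ | y
  · exact h.opAt_ne hzw _
  · exact h.opAt_ne hzw _
  · exact (h.opAt_ne hzw _).add y

theorem add_add (η : Conf V) (x y : V) : addAt (addAt η x) y = addAt (addAt η y) x :=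
  opAt_comm _ _ _ _ _ (fun _ => rfl)

theorem add_rem {η : Conf V} {z : V} (h : Act η z) (x : V) :
    addAt (remAt η z) x = remAt (addAt η x) z := by
  apply opAt_comm
  rintro rfl
  obtain ⟨n, hn⟩ := h
  rw [hn]
  cases n <;> rfl

theorem add_slp {η : Conf V} {z : V} (h : Act η z) (x : V) :
    addAt (slpAt η z) x = slpAt (addAt η x) z := by
  apply opAt_comm
  rintro rfl
  obtain ⟨n, hn⟩ := h
  rw [hn]
  cases n <;> rfl

theorem add_act {η : Conf V} {z : V} (h : Act η z) (x : V) (i : Option (Option V)) :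
    addAt (act z i η) x = act z i (addAt η x) := by
  rcases i with _ | _ | y
  · exact add_slp h x
  · exact add_rem h x
  · show addAt (addAt (remAt η z) y) x = addAt (remAt (addAt η x) z) y
    rw [add_add, add_rem h]

theorem act_comm {η : Conf V} {z w : V} (hz : Act η z) (hw : Act η w) (hzw : z ≠ w)
    (i j : Option (Option V)) : act w j (act z i η) = act z i (act w j η) := by
  have aux : ∀ (u v : Site → Site), opAt u (opAt v η z) w = opAt v (opAt u η w) z :=
    fun u v => opAt_comm u v η w z (fun h => absurd h.symm hzw)
  have aux2 : ∀ (η : Conf V) z y, act z (some (some y)) η = addAt (act z (some none) η) y :=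
    fun _ _ _ => rfl
  have base : ∀ i j : Option (Option V), (i = none ∨ i = some none) →
      (j = none ∨ j = some none) → act w j (act z i η) = act z i (act w j η) := by
    rintro i j (rfl | rfl) (rfl | rfl) <;> exact aux _ _
  have half : ∀ i j : Option (Option V), (i = none ∨ i = some none) →
      act w j (act z i η) = act z i (act w j η) := by
    intro i j hi
    rcases j with _ | _ | y
    · exact base _ _ hi (Or.inl rfl)
    · exact base _ _ hi (Or.inr rfl)
    · rw [aux2, aux2, base _ _ hi (Or.inr rfl), add_act (hz.act_ne hzw.symm _)]
  rcases i with _ | _ | y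
  · exact half _ _ (Or.inl rfl)
  · exact half _ _ (Or.inr rfl)
  · rw [aux2, aux2, ← half _ _ (Or.inr rfl), add_act (hw.act_ne hzw _)]

noncomputable def wt (K : V → V → ℝ≥0∞) (l : ℝ≥0∞) (z : V) : Option (Option V) → ℝ≥0∞
  | none => l * (l+1)⁻¹
  | some none => (1 - ∑ y, K z y) * (l+1)⁻¹
  | some (some y) => K z y * (l+1)⁻¹

noncomputable def LL (K : V → V → ℝ≥0∞) (l : ℝ≥0∞) (z : V) (F : Conf V → ℝ≥0∞) (η : Conf V) :
    ℝ≥0∞ := ∑ i, wt K l z i * F (act z i η)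

/-- the average over moves -/
noncomputable def MV (K : V → V → ℝ≥0∞) (z : V) (F : Conf V → ℝ≥0∞) (η : Conf V) :
    ℝ≥0∞ := (∑ y, K z y * F (addAt (remAt η z) y)) + (1 - ∑ y, K z y) * F (remAt η z)

variable {K : V → V → ℝ≥0∞} {l : ℝ≥0∞}

theorem LL_eq (z : V) (F : Conf V → ℝ≥0∞) (η : Conf V) :
    LL K l z F η = l * (l+1)⁻¹ * F (slpAt η z) + (l+1)⁻¹ * MV K z F η := by
  unfold LL MV
  rw [Fintype.sum_option, Fintype.sum_option, mul_add, Finset.mul_sum, add_comm (_ * _) (∑ y, _)]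
  congr 1
  congr 1
  · refine Finset.sum_congr rfl fun y _ => ?_
    simp only [wt, act]; ring
  · simp only [wt, act]; ring

theorem pq (hl : l ≠ ⊤) : l * (l+1)⁻¹ + (l+1)⁻¹ = 1 := by
  have : l * (l+1)⁻¹ + (l+1)⁻¹ = (l+1) * (l+1)⁻¹ := by ring
  rw [this, ENNReal.mul_inv_cancel (by simp) (by simp [hl])]

theorem MV_const (hsub : SubStochastic K) (z : V) (c : ℝ≥0∞) (η : Conf V) :
    MV K z (fun _ => c) η = c := by
  unfold MV
  rw [← Finset.sum_mul, ← add_mul, add_tsub_cancel_of_le (hsub z), one_mul]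

theorem LL_const (hsub : SubStochastic K) (hl : l ≠ ⊤) (z : V) (c : ℝ≥0∞) (η : Conf V) :
    LL K l z (fun _ => c) η = c := by
  rw [LL_eq, MV_const hsub, ← add_mul, pq hl, one_mul]

theorem LL_mono {z : V} {F G : Conf V → ℝ≥0∞} {η : Conf V}
    (h : ∀ i, F (act z i η) ≤ G (act z i η)) : LL K l z F η ≤ LL K l z G η :=
  Finset.sum_le_sum fun i _ => mul_le_mul_right (h i) _

theorem LL_congr {z : V} {F G : Conf V → ℝ≥0∞} {η : Conf V}
    (h : ∀ i, F (act z i η) = G (act z i η)) : LL K l z F η = LL K l z G η :=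
  Finset.sum_congr rfl fun i _ => by rw [h i]

theorem LL_add (z : V) (F G : Conf V → ℝ≥0∞) (η : Conf V) :
    LL K l z (fun ζ => F ζ + G ζ) η = LL K l z F η + LL K l z G η := by
  simp only [LL, mul_add, Finset.sum_add_distrib]

theorem LL_mul (z : V) (c : ℝ≥0∞) (F : Conf V → ℝ≥0∞) (η : Conf V) :
    LL K l z (fun ζ => c * F ζ) η = c * LL K l z F η := by
  simp only [LL, Finset.mul_sum]
  exact Finset.sum_congr rfl fun i _ => by ring

theorem LL_sum {ι : Type} (s : Finset ι) (z : V) (F : ι → Conf V → ℝ≥0∞) (η : Conf V) :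
    LL K l z (fun ζ => ∑ i ∈ s, F i ζ) η = ∑ i ∈ s, LL K l z (F i) η := by
  simp only [LL, Finset.mul_sum]
  exact Finset.sum_comm

theorem LL_comm {η : Conf V} {z w : V} (hz : Act η z) (hw : Act η w) (hzw : z ≠ w)
    (F : Conf V → ℝ≥0∞) :
    LL K l z (LL K l w F) η = LL K l w (LL K l z F) η := by
  simp only [LL, Finset.mul_sum]
  rw [Finset.sum_comm]
  refine Finset.sum_congr rfl fun i _ => Finset.sum_congr rfl fun j _ => ?_
  rw [act_comm hz hw hzw]; ring

theorem LL_iSup (z : V) (F : ℕ → Conf V → ℝ≥0∞) (hF : ∀ η, Monotone fun n => F n η)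
    (η : Conf V) : LL K l z (fun ζ => ⨆ n, F n ζ) η = ⨆ n, LL K l z (F n) η := by
  simp only [LL, ENNReal.mul_iSup]
  refine ENNReal.finsetSum_iSup_of_monotone fun i => ?_
  intro a b hab
  exact mul_le_mul_right (hF _ hab) _

theorem mem_activeSites (η : Conf V) (z : V) : z ∈ activeSites η ↔ Act η z := by
  unfold activeSites Act
  simp only [Finset.mem_filter, Finset.mem_univ, true_and]
  cases η z <;> simp [Site.isActive]

def Unst (η : Conf V) : Prop := (activeSites η).Nonempty

theorem unst_iff (η : Conf V) : Unst η ↔ ∃ z, Act η z := by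
  unfold Unst Finset.Nonempty
  simp only [mem_activeSites]

theorem Unst.choose_act {η : Conf V} (h : (activeSites η).Nonempty) : Act η h.choose :=
  (mem_activeSites _ _).1 h.choose_spec

open Classical in
noncomputable def hh (K : V → V → ℝ≥0∞) (l : ℝ≥0∞) (b : Conf V → ℝ≥0∞) : ℕ → Conf V → ℝ≥0∞
  | 0 => fun η => if Unst η then 0 else b η
  | n+1 => fun η => if h : Unst η then LL K l (Exists.choose h) (hh K l b n) η else b η

theorem hh_stable {b : Conf V → ℝ≥0∞} {η : Conf V} (h : ¬ Unst η) (n : ℕ) : hh K l b n η = b η := by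
  cases n <;> simp [hh, h]

theorem hh_zero {b : Conf V → ℝ≥0∞} {η : Conf V} (h : Unst η) : hh K l b 0 η = 0 := by
  simp [hh, h]

theorem hh_succ_choose {b : Conf V → ℝ≥0∞} {η : Conf V} (h : Unst η) (n : ℕ) :
    hh K l b (n+1) η = LL K l (Exists.choose h) (hh K l b n) η := by
  simp [hh, h]

theorem hh_succ (b : Conf V → ℝ≥0∞) (n : ℕ) : ∀ {η : Conf V} {z : V}, Act η z →
    hh K l b (n+1) η = LL K l z (hh K l b n) η := by
  induction n with
  | zero =>
    intro η z hz
    have hu : Unst η := (unst_iff η).2 ⟨z, hz⟩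
    rw [hh_succ_choose hu]
    have hc : Act η (Exists.choose hu) := Unst.choose_act hu
    by_cases hcz : Exists.choose hu = z
    · rw [hcz]
    · have e1 : LL K l (Exists.choose hu) (hh K l b 0) η
          = LL K l (Exists.choose hu) (fun _ => 0) η :=
        LL_congr fun i => hh_zero ((unst_iff _).2 ⟨z, hz.act_ne hcz i⟩)
      have e2 : LL K l z (hh K l b 0) η = LL K l z (fun _ => 0) η :=
        LL_congr fun i => hh_zero ((unst_iff _).2 ⟨_, hc.act_ne (Ne.symm hcz) i⟩)
      rw [e1, e2]; simp [LL]
  | succ n ih =>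
    intro η z hz
    have hu : Unst η := (unst_iff η).2 ⟨z, hz⟩
    rw [hh_succ_choose hu]
    have hc : Act η (Exists.choose hu) := Unst.choose_act hu
    by_cases hcz : Exists.choose hu = z
    · rw [hcz]
    · have e1 : LL K l (Exists.choose hu) (hh K l b (n+1)) η
          = LL K l (Exists.choose hu) (LL K l z (hh K l b n)) η :=
        LL_congr fun i => ih (hz.act_ne hcz i)
      have e2 : LL K l z (hh K l b (n+1)) η
          = LL K l z (LL K l (Exists.choose hu) (hh K l b n)) η :=
        LL_congr fun i => ih (hc.act_ne (Ne.symm hcz) i)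
      rw [e1, e2, LL_comm hc hz hcz]

theorem hh_mono (b : Conf V → ℝ≥0∞) (η : Conf V) : Monotone fun n => hh K l b n η := by
  refine monotone_nat_of_le_succ fun n => ?_
  induction n generalizing η with
  | zero =>
    by_cases h : Unst η
    · rw [hh_zero h]; exact zero_le
    · rw [hh_stable h, hh_stable h]
  | succ n ih =>
    by_cases h : Unst η
    · rw [hh_succ_choose h, hh_succ_choose h]
      exact LL_mono fun i => ih _
    · rw [hh_stable h, hh_stable h]

noncomputable def HH (K : V → V → ℝ≥0∞) (l : ℝ≥0∞) (b : Conf V → ℝ≥0∞) (η : Conf V) : ℝ≥0∞ :=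
  ⨆ n, hh K l b n η

def Harm (K : V → V → ℝ≥0∞) (l : ℝ≥0∞) (F : Conf V → ℝ≥0∞) : Prop :=
  ∀ η z, Act η z → F η = LL K l z F η

theorem HH_stable {b : Conf V → ℝ≥0∞} {η : Conf V} (h : ¬ Unst η) : HH K l b η = b η := by
  simp [HH, hh_stable h]

theorem HH_harm (b : Conf V → ℝ≥0∞) : Harm K l (HH K l b) := by
  intro η z hz
  have := LL_iSup (K := K) (l := l) z (hh K l b) (hh_mono b) η
  unfold HH
  rw [this]
  have h2 : ∀ n, LL K l z (hh K l b n) η = hh K l b (n+1) η := fun n => (hh_succ b n hz).symm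
  simp only [h2]
  exact ((hh_mono b η).iSup_nat_add 1).symm

theorem HH_le {b g : Conf V → ℝ≥0∞} (hb : ∀ η, ¬ Unst η → b η ≤ g η)
    (hg : ∀ η (h : Unst η), LL K l (Exists.choose h) g η ≤ g η) (η : Conf V) :
    HH K l b η ≤ g η := by
  refine iSup_le fun n => ?_
  induction n generalizing η with
  | zero =>
    by_cases h : Unst η
    · rw [hh_zero h]; exact zero_le
    · rw [hh_stable h]; exact hb _ h
  | succ n ih =>
    by_cases h : Unst η
    · rw [hh_succ_choose h]
      exact (LL_mono fun i => ih _).trans (hg η h)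
    · rw [hh_stable h]; exact hb _ h

theorem Harm.comp_add {F : Conf V → ℝ≥0∞} (hF : Harm K l F) (x : V) :
    Harm K l (fun η => F (addAt η x)) := by
  intro η z hz
  show F (addAt η x) = _
  rw [hF _ z (hz.add x)]
  exact Finset.sum_congr rfl fun i _ => by
    show _ = wt K l z i * F (addAt (act z i η) x)
    rw [add_act hz]

theorem Harm.sum {ι : Type} (s : Finset ι) (c : ι → ℝ≥0∞) {F : ι → Conf V → ℝ≥0∞}
    (hF : ∀ i, Harm K l (F i)) : Harm K l (fun η => ∑ i ∈ s, c i * F i η) := by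
  intro η z hz
  rw [LL_sum]
  refine Finset.sum_congr rfl fun i _ => ?_
  rw [LL_mul, ← hF i η z hz]

/-- harmonic functions satisfy the move equation at non-alone sites -/
theorem Harm.mv {F : Conf V → ℝ≥0∞} (hF : Harm K l F) (hl : l ≠ ⊤) {η : Conf V} {z : V} {n : ℕ}
    (hz : η z = Site.active (n+1)) (hfin : F η ≠ ⊤) : F η = MV K z F η := by
  have h := hF η z ⟨_, hz⟩
  rw [LL_eq] at h
  have hs : slpAt η z = η := by
    unfold slpAt opAt; rw [hz]; exact Function.update_eq_self_iff.2 hz.symm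
  rw [hs] at h
  have h1 : F η = l * (l+1)⁻¹ * F η + (l+1)⁻¹ * F η := by rw [← add_mul, pq hl, one_mul]
  have hne : l * (l+1)⁻¹ * F η ≠ ⊤ := by
    refine ENNReal.mul_ne_top (ENNReal.mul_ne_top hl ?_) hfin
    simp
  have h2 := (ENNReal.add_right_inj hne).1 (h1.symm.trans h)
  exact (ENNReal.mul_right_inj (a := (l+1)⁻¹) (by simp [hl]) (by simp)).1 h2

theorem maxprinc (hsub : SubStochastic K) (hnd : NonDegenerate K) (d : V → ℝ)
    (hd : ∀ x, d x ≤ 0 ∨ d x ≤ ∑ y, (K x y).toReal * d y) (x : V) : d x ≤ 0 := by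
  by_contra hx
  push Not at hx
  obtain ⟨x0, -, hx0⟩ := Finset.exists_max_image Finset.univ d ⟨x, Finset.mem_univ x⟩
  have hM : 0 < d x0 := lt_of_lt_of_le hx (hx0 x (Finset.mem_univ x))
  set M := d x0 with hMdef
  obtain ⟨w, hwS, hw⟩ := hnd (Finset.univ.filter fun y => d y = M) ⟨x0, by simp [hMdef]⟩
  apply hw
  have hdw : d w = M := by simpa using hwS
  have hKfin : ∀ y, K w y ≠ ⊤ := fun y =>
    ne_top_of_le_ne_top ENNReal.one_ne_top
      ((Finset.single_le_sum (f := fun y => K w y) (fun _ _ => zero_le) (Finset.mem_univ y)).trans (hsub w))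
  have hsum : ∑ y, (K w y).toReal ≤ 1 := by
    rw [← ENNReal.toReal_sum (fun y _ => hKfin y)]
    simpa using ENNReal.toReal_mono ENNReal.one_ne_top (hsub w)
  have h1 : M ≤ ∑ y, (K w y).toReal * d y := by
    rcases hd w with h | h
    · linarith
    · rwa [hdw] at h
  have h0 : ∀ y ∈ Finset.univ, 0 ≤ (K w y).toReal * (M - d y) := fun y hy =>
    mul_nonneg ENNReal.toReal_nonneg (by linarith [hx0 y hy])
  have h2 : ∑ y, (K w y).toReal * (M - d y) = (∑ y, (K w y).toReal) * M - ∑ y, (K w y).toReal * d y := by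
    rw [Finset.sum_mul, ← Finset.sum_sub_distrib]
    exact Finset.sum_congr rfl fun y _ => by ring
  have h3 : ∑ y, (K w y).toReal * (M - d y) = 0 := by
    apply le_antisymm _ (Finset.sum_nonneg h0)
    rw [h2]
    nlinarith
  have h4 := (Finset.sum_eq_zero_iff_of_nonneg h0).1 h3
  have h5 : ∑ y, (K w y).toReal = 1 := by
    rw [h2] at h3
    apply le_antisymm hsum
    by_contra hlt
    push Not at hlt
    nlinarith
  have h6 : ∑ y ∈ Finset.univ.filter (fun y => d y = M), K w y = ∑ y, K w y := by
    apply Finset.sum_subset (Finset.subset_univ _)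
    intro y hy hyS
    have := h4 y hy
    rcases mul_eq_zero.1 this with h | h
    · exact ((ENNReal.toReal_eq_zero_iff _).1 h).resolve_right (hKfin y)
    · exact absurd (by simp; linarith) hyS
  rw [h6]
  rw [← ENNReal.toReal_sum (fun y _ => hKfin y)] at h5
  exact (ENNReal.toReal_eq_one_iff _).1 h5

theorem K_ne_top (hsub : SubStochastic K) (x y : V) : K x y ≠ ⊤ :=
    ne_top_of_le_ne_top ENNReal.one_ne_top
      ((Finset.single_le_sum (f := fun y => K x y) (fun _ _ => zero_le) (Finset.mem_univ y)).trans (hsub x))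

theorem exists_G (hsub : SubStochastic K) (hnd : NonDegenerate K) :
    ∃ G : V → ℝ≥0∞, (∀ x, G x ≠ ⊤) ∧ ∀ x, 1 + ∑ y, K x y * G y ≤ G x := by
  let A : Matrix V V ℝ := Matrix.of fun x y => (K x y).toReal
  let T : (V → ℝ) →ₗ[ℝ] (V → ℝ) := LinearMap.id - A.mulVecLin
  have hT : ∀ u x, T u x = u x - ∑ y, (K x y).toReal * u y := by
    intro u x
    simp [T, A, Matrix.mulVec, dotProduct]
  have hinj : Function.Injective T := by
    rw [← LinearMap.ker_eq_bot, LinearMap.ker_eq_bot']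
    intro u hu
    have hu' : ∀ x, u x = ∑ y, (K x y).toReal * u y := by
      intro x
      have := congrFun hu x
      rw [hT] at this
      simpa [sub_eq_zero] using this
    funext x
    apply le_antisymm
    · exact maxprinc hsub hnd u (fun x => Or.inr (hu' x).le) x
    · have := maxprinc hsub hnd (fun x => - u x) (fun x => Or.inr (by
        simp only [mul_neg, Finset.sum_neg_distrib]; rw [← hu' x])) x
      simpa using this
  obtain ⟨u, hu⟩ := (LinearMap.injective_iff_surjective.1 hinj) (fun _ => 1)
  have hu' : ∀ x, u x = 1 + ∑ y, (K x y).toReal * u y := by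
    intro x
    have := congrFun hu x
    rw [hT] at this
    linarith
  have hpos : ∀ x, 0 ≤ u x := by
    intro x
    have := maxprinc hsub hnd (fun x => - u x) (fun x => Or.inr (by
        simp only [mul_neg, Finset.sum_neg_distrib]; linarith [hu' x])) x
    simpa using this
  refine ⟨fun x => ENNReal.ofReal (u x), fun x => ENNReal.ofReal_ne_top, fun x => ?_⟩
  show _ ≤ ENNReal.ofReal (u x)
  rw [hu' x, ENNReal.ofReal_add zero_le_one
    (Finset.sum_nonneg fun y _ => mul_nonneg ENNReal.toReal_nonneg (hpos y)), ENNReal.ofReal_one,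
    ENNReal.ofReal_sum_of_nonneg fun y _ => mul_nonneg ENNReal.toReal_nonneg (hpos y)]
  refine add_le_add le_rfl (Finset.sum_le_sum fun y _ => ?_)
  rw [ENNReal.ofReal_mul ENNReal.toReal_nonneg, ENNReal.ofReal_toReal (K_ne_top hsub x y)]

theorem walk_uniq (hsub : SubStochastic K) (hnd : NonDegenerate K) (u v c : V → ℝ≥0∞)
    (hu : ∀ x, u x ≠ ⊤) (hv : ∀ x, v x ≠ ⊤)
    (h : ∀ x, u x = v x ∨ (u x = (∑ y, K x y * u y) + c x ∧ v x = (∑ y, K x y * v y) + c x)) :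
    u = v := by
  have key : ∀ x, (u x).toReal - (v x).toReal = 0 ∨ (u x).toReal - (v x).toReal
      = ∑ y, (K x y).toReal * ((u y).toReal - (v y).toReal) := by
    intro x
    rcases h x with h | ⟨h1, h2⟩
    · left; rw [h]; ring
    · right
      have hs : ∀ w : V → ℝ≥0∞, (∀ y, w y ≠ ⊤) → (∑ y, K x y * w y).toReal
          = ∑ y, (K x y).toReal * (w y).toReal := by
        intro w hw
        rw [ENNReal.toReal_sum fun y _ => ENNReal.mul_ne_top (K_ne_top hsub x y) (hw y)]
        simp
      have hsf : ∀ w : V → ℝ≥0∞, (∀ y, w y ≠ ⊤) → (∑ y, K x y * w y) ≠ ⊤ := fun w hw =>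
        ENNReal.sum_ne_top.2 fun y _ => ENNReal.mul_ne_top (K_ne_top hsub x y) (hw y)
      have hc : c x ≠ ⊤ := ne_top_of_le_ne_top (hu x) (by rw [h1]; exact le_add_self)
      rw [h1, h2, ENNReal.toReal_add (hsf u hu) hc, ENNReal.toReal_add (hsf v hv) hc, hs u hu, hs v hv]
      simp only [mul_sub, Finset.sum_sub_distrib]
      ring
  funext x
  have a1 := maxprinc hsub hnd (fun x => (u x).toReal - (v x).toReal)
    (fun x => (key x).imp le_of_eq le_of_eq) x
  have a2 := maxprinc hsub hnd (fun x => (v x).toReal - (u x).toReal)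
    (fun x => (key x).imp (fun h => by linarith) (fun h => by
      have : ∑ y, (K x y).toReal * ((v y).toReal - (u y).toReal) =
        - ∑ y, (K x y).toReal * ((u y).toReal - (v y).toReal) := by
        rw [← Finset.sum_neg_distrib]; exact Finset.sum_congr rfl fun y _ => by ring
      linarith)) x
  exact (ENNReal.toReal_eq_toReal_iff' (hu x) (hv x)).1 (by linarith)

def tot {M : Type} [AddCommMonoid M] (φ : V → Site → M) (η : Conf V) : M := ∑ x, φ x (η x)

theorem tot_op {M : Type} [AddCommMonoid M] (φ : V → Site → M) (u : Site → Site) (η : Conf V)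
    (z : V) : tot φ (opAt u η z) + φ z (η z) = tot φ η + φ z (u (η z)) := by
  unfold tot
  rw [← Finset.add_sum_erase _ _ (Finset.mem_univ z),
    ← Finset.add_sum_erase Finset.univ (fun x => φ x (η x)) (Finset.mem_univ z)]
  have : ∑ x ∈ Finset.univ.erase z, φ x (opAt u η z x) = ∑ x ∈ Finset.univ.erase z, φ x (η x) := by
    refine Finset.sum_congr rfl fun x hx => ?_
    rw [opAt, Function.update_of_ne (Finset.ne_of_mem_erase hx)]
  rw [this]
  have h2 : opAt u η z z = u (η z) := by simp [opAt]
  rw [h2]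
  abel

noncomputable def phi (l : ℝ≥0∞) (G : V → ℝ≥0∞) (x : V) : Site → ℝ≥0∞
  | .empty => 0
  | .sleeping => (l+1+1) * G x
  | .active n => (n+1) * ((l+1+1) * G x + 1)

theorem drift (hsub : SubStochastic K) (hl : l ≠ ⊤) (G : V → ℝ≥0∞) (hG : ∀ x, G x ≠ ⊤)
    (hG1 : ∀ x, 1 + ∑ y, K x y * G y ≤ G x) (η : Conf V) (z : V) (hz : Act η z) :
    LL K l z (tot (phi l G)) η + 1 ≤ tot (phi l G) η := by
  obtain ⟨n, hn⟩ := hz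
  have hfin : ∀ x s, phi l G x s ≠ ⊤ := by
    intro x s
    cases s <;> simp [phi, ENNReal.mul_eq_top, hG, hl]
  set a := l+1+1 with ha
  set Φ := tot (phi l G)
  have hrem : Φ (remAt η z) + (a * G z + 1) = Φ η := by
    have h := tot_op (phi l G) Site.removeOne η z
    have e : phi l G z (η z) = phi l G z ((η z).removeOne) + (a * G z + 1) := by
      rw [hn]; cases n <;> simp [phi, Site.removeOne, ha]
      ring
    rw [e] at h
    have h' : (Φ (remAt η z) + (a * G z + 1)) + phi l G z ((η z).removeOne)
      = Φ η + phi l G z ((η z).removeOne) := by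
      rw [← h]; show _ = Φ (remAt η z) + _; ring
    exact (ENNReal.add_left_inj (hfin _ _)).1 h'
  have hadd : ∀ y, Φ (addAt (remAt η z) y) ≤ Φ (remAt η z) + (a * G y + 2) := by
    intro y
    set ζ := remAt η z
    have h := tot_op (phi l G) Site.addActive ζ y
    have e : phi l G y ((ζ y).addActive) ≤ phi l G y (ζ y) + (a * G y + 2) := by
      cases ζ y with
      | empty =>
        simp only [phi, Site.addActive, ← ha]
        simp
        gcongr
        exact one_le_two
      | sleeping =>
        simp only [phi, Site.addActive, ← ha]
        apply le_of_eq; push_cast; ring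
      | active n =>
        simp only [phi, Site.addActive, ← ha]
        have : ((n+1 : ℕ) + 1 : ℝ≥0∞) * (a * G y + 1) = (n+1) * (a * G y + 1) + (a * G y + 1) := by
          push_cast; ring
        rw [this]
        gcongr
        exact one_le_two
    have h' : Φ (addAt ζ y) + phi l G y (ζ y) ≤ (Φ ζ + (a * G y + 2)) + phi l G y (ζ y) := by
      show tot (phi l G) (opAt Site.addActive ζ y) + _ ≤ _
      rw [h, add_assoc, add_comm (a * G y + 2)]
      gcongr
    exact (ENNReal.add_le_add_iff_right (hfin _ _)).1 h'
  have hslp : Φ (slpAt η z) ≤ Φ η := by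
    have h := tot_op (phi l G) Site.slp η z
    have e : phi l G z ((η z).slp) ≤ phi l G z (η z) := by
      rw [hn]; cases n <;> simp [phi, Site.slp]
    have h' : Φ (slpAt η z) + phi l G z (η z) ≤ Φ η + phi l G z (η z) := by
      show tot (phi l G) (opAt Site.slp η z) + _ ≤ _
      rw [h]; gcongr
    exact (ENNReal.add_le_add_iff_right (hfin _ _)).1 h'
  have hMV : MV K z Φ η + (l+1) ≤ Φ η := by
    have h1 : MV K z Φ η ≤ Φ (remAt η z) + a * (∑ y, K z y * G y) + 2 := by
      unfold MV
      calc _ ≤ (∑ y, K z y * (Φ (remAt η z) + (a * G y + 2))) + (1 - ∑ y, K z y) * Φ (remAt η z) := by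
            gcongr; exact hadd _
        _ = ((∑ y, K z y) + (1 - ∑ y, K z y)) * Φ (remAt η z) + a * (∑ y, K z y * G y)
            + (∑ y, K z y) * 2 := by
            simp only [mul_add, Finset.sum_add_distrib, ← Finset.sum_mul]
            have : ∑ y, K z y * (a * G y) = a * ∑ y, K z y * G y := by
              rw [Finset.mul_sum]; exact Finset.sum_congr rfl fun y _ => by ring
            rw [this]; ring
        _ ≤ _ := by
            rw [add_tsub_cancel_of_le (hsub z), one_mul]
            gcongr
            exact mul_le_of_le_one_left' (hsub z)
    have h2 : MV K z Φ η + (l+1) + 1 ≤ Φ η + 1 := by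
      calc _ ≤ Φ (remAt η z) + a * (∑ y, K z y * G y) + 2 + (l+1) + 1 := by gcongr
        _ = Φ (remAt η z) + a * (1 + ∑ y, K z y * G y) + 2 := by rw [ha]; ring
        _ ≤ Φ (remAt η z) + a * G z + 2 := by gcongr; exact hG1 z
        _ = Φ (remAt η z) + (a * G z + 1) + 1 := by ring
        _ = _ := by rw [hrem]
    exact (ENNReal.add_le_add_iff_right ENNReal.one_ne_top).1 h2
  rw [LL_eq]
  calc _ = l * (l+1)⁻¹ * Φ (slpAt η z) + ((l+1)⁻¹ * MV K z Φ η + (l+1)⁻¹ * (l+1)) := by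
        rw [ENNReal.inv_mul_cancel (by simp) (by simp [hl]), add_assoc]
    _ ≤ l * (l+1)⁻¹ * Φ η + (l+1)⁻¹ * Φ η := by
        rw [← mul_add]; gcongr
    _ = _ := by rw [← add_mul, pq hl, one_mul]

open Classical in
noncomputable def rr (K : V → V → ℝ≥0∞) (l : ℝ≥0∞) : ℕ → Conf V → ℝ≥0∞
  | 0 => fun η => if Unst η then 1 else 0
  | n+1 => fun η => if h : Unst η then LL K l (Exists.choose h) (rr K l n) η else 0

theorem rr_le_one (hsub : SubStochastic K) (hl : l ≠ ⊤) (n : ℕ) (η : Conf V) : rr K l n η ≤ 1 := by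
  induction n generalizing η with
  | zero => simp only [rr]; split_ifs <;> simp
  | succ n ih =>
    simp only [rr]
    split_ifs with h
    · refine (LL_mono (G := fun _ => 1) fun i => ih _).trans ?_
      rw [LL_const hsub hl]
    · simp

theorem rr_le (hsub : SubStochastic K) (hl : l ≠ ⊤) (G : V → ℝ≥0∞) (hG : ∀ x, G x ≠ ⊤)
    (hG1 : ∀ x, 1 + ∑ y, K x y * G y ≤ G x) (n : ℕ) (η : Conf V) :
    n * rr K l n η ≤ tot (phi l G) η := by
  induction n generalizing η with
  | zero => simp
  | succ n ih =>
    simp only [rr]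
    split_ifs with h
    · have := drift hsub hl G hG hG1 η _ (Unst.choose_act h)
      refine le_trans ?_ this
      push_cast
      rw [add_mul, one_mul, ← LL_mul]
      gcongr
      · exact LL_mono fun i => ih _
      · refine (LL_mono (G := fun _ => 1) fun i => rr_le_one hsub hl n _).trans ?_
        rw [LL_const hsub hl]
    · simp

theorem tot_phi_ne_top (hl : l ≠ ⊤) (G : V → ℝ≥0∞) (hG : ∀ x, G x ≠ ⊤) (η : Conf V) :
    tot (phi l G) η ≠ ⊤ := by
  unfold tot
  refine ENNReal.sum_ne_top.2 fun x _ => ?_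
  cases η x <;> simp [phi, ENNReal.mul_eq_top, hG, hl]

theorem harm_unique (hsub : SubStochastic K) (hnd : NonDegenerate K) (hl : l ≠ ⊤)
    {F : Conf V → ℝ≥0∞} (hF : Harm K l F) {C : ℝ≥0∞} (hC : C ≠ ⊤) (hFC : ∀ η, F η ≤ C)
    (b : Conf V → ℝ≥0∞) (hb : ∀ η, ¬ Unst η → F η = b η) (η : Conf V) :
    F η = HH K l b η := by
  apply le_antisymm
  · obtain ⟨G, hG, hG1⟩ := exists_G hsub hnd
    have h1 : ∀ n η, F η ≤ hh K l b n η + C * rr K l n η := by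
      intro n
      induction n with
      | zero =>
        intro η
        by_cases h : Unst η
        · simpa [hh, rr, h] using hFC η
        · simp [hh, rr, h, hb]
      | succ n ih =>
        intro η
        by_cases h : Unst η
        · rw [hF η _ (Unst.choose_act h)]
          simp only [hh, rr, h, dif_pos]
          rw [← LL_mul, ← LL_add]
          exact LL_mono fun i => ih _
        · simp [hh, rr, h, hb]
    have h2 : ∀ n : ℕ, F η ≤ HH K l b η + C * (tot (phi l G) η * ((n : ℝ≥0∞) + 1)⁻¹) := by
      intro n
      refine (h1 (n+1) η).trans ?_
      gcongr
      · exact le_iSup (fun n => hh K l b n η) (n+1)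
      · rw [← ENNReal.div_eq_inv_mul.trans (mul_comm _ _),
          ENNReal.le_div_iff_mul_le (by simp) (by simp), mul_comm]
        exact_mod_cast rr_le hsub hl G hG hG1 (n+1) η
    have h3 : Tendsto (fun n : ℕ => HH K l b η + C * (tot (phi l G) η * ((n : ℝ≥0∞) + 1)⁻¹)) atTop
        (nhds (HH K l b η + C * (tot (phi l G) η * 0))) := by
      refine Tendsto.const_add _ (ENNReal.Tendsto.const_mul (ENNReal.Tendsto.const_mul ?_ ?_) ?_)
      · have := (tendsto_add_atTop_iff_nat (f := fun n : ℕ => (n : ℝ≥0∞)⁻¹) 1).2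
          ENNReal.tendsto_inv_nat_nhds_zero
        simpa using this
      · right; exact tot_phi_ne_top hl G hG η
      · right; exact hC
    have := ge_of_tendsto' h3 h2
    simpa using this
  · apply HH_le
    · intro η h; rw [hb η h]
    · intro η h; rw [← hF η _ (Unst.choose_act h)]

theorem MV_eq_LL (z : V) (F : Conf V → ℝ≥0∞) (η : Conf V) : MV K z F η = LL K 0 z F η := by
  rw [LL_eq]; simp

theorem tsum_topple (lam : ℝ) (η : Conf V) (g : Conf V → ℝ≥0∞) (h : Unst η) :
    ∑' σ, toppleKernel K lam η σ * g σ =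
      if η (Exists.choose h) = Site.active 0 then LL K (ENNReal.ofReal lam) (Exists.choose h) g η
      else MV K (Exists.choose h) g η := by
  have hne : (activeSites η).Nonempty := h
  set x := Exists.choose h with hx
  have hdie : ∀ (c : Conf V) (a : ℝ≥0∞), ∑' σ : Conf V, (if σ = c then a else 0) * g σ = a * g c := by
    intro c a
    rw [tsum_eq_single c]
    · simp
    · intro σ hσ; simp [hσ]
  have hmv : ∑' σ : Conf V, ((∑ y, if σ = addActiveAt (Function.update η x (η x).removeOne) y then K x y else 0)
      + (if σ = Function.update η x (η x).removeOne then 1 - ∑ y, K x y else 0)) * g σ = MV K x g η := by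
    simp only [add_mul, Finset.sum_mul]
    rw [ENNReal.tsum_add, hdie, Summable.tsum_finsetSum (fun _ _ => ENNReal.summable)]
    simp only [hdie]
    rfl
  have hM : ∀ σ, toppleKernel K lam η σ = if η x = Site.active 0 then
      ((if σ = Function.update η x Site.sleeping then ENNReal.ofReal lam else 0) +
        (∑ y, if σ = addActiveAt (Function.update η x (η x).removeOne) y then K x y else 0)
        + (if σ = Function.update η x (η x).removeOne then 1 - ∑ y, K x y else 0))
        / (ENNReal.ofReal lam + 1)
      else (∑ y, if σ = addActiveAt (Function.update η x (η x).removeOne) y then K x y else 0)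
        + (if σ = Function.update η x (η x).removeOne then 1 - ∑ y, K x y else 0) := by
    intro σ
    unfold toppleKernel
    rw [dif_pos hne]
  simp only [hM]
  split_ifs with h0
  · have e : ∀ σ : Conf V, ((if σ = Function.update η x Site.sleeping then ENNReal.ofReal lam else 0) +
        (∑ y, if σ = addActiveAt (Function.update η x (η x).removeOne) y then K x y else 0)
        + (if σ = Function.update η x (η x).removeOne then 1 - ∑ y, K x y else 0))
        / (ENNReal.ofReal lam + 1) * g σ
        = (ENNReal.ofReal lam + 1)⁻¹ * ((if σ = Function.update η x Site.sleeping then ENNReal.ofReal lam else 0) * g σ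
        + (((∑ y, if σ = addActiveAt (Function.update η x (η x).removeOne) y then K x y else 0)
        + (if σ = Function.update η x (η x).removeOne then 1 - ∑ y, K x y else 0)) * g σ)) := by
      intro σ
      rw [div_eq_mul_inv]; ring
    simp only [e]
    rw [ENNReal.tsum_mul_left, ENNReal.tsum_add, hdie, hmv, LL_eq]
    have : slpAt η x = Function.update η x Site.sleeping := by
      unfold slpAt opAt; rw [h0]; rfl
    rw [this]; ring
  · exact hmv

theorem tsum_topple_stable (lam : ℝ) (η : Conf V) (g : Conf V → ℝ≥0∞) (h : ¬ Unst η) :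
    ∑' σ, toppleKernel K lam η σ * g σ = g η := by
  have hne : ¬ (activeSites η).Nonempty := h
  have : ∀ σ, toppleKernel K lam η σ = if σ = η then 1 else 0 := by
    intro σ; unfold toppleKernel; rw [dif_neg hne]
  simp only [this]
  rw [tsum_eq_single η]
  · simp
  · intro σ hσ; simp [hσ]

def delta (ξ : V → Bool) (η : Conf V) : ℝ≥0∞ := if embed ξ = η then 1 else 0

theorem embed_stable (ξ : V → Bool) : ¬ Unst (embed ξ) := by
  rw [unst_iff]
  rintro ⟨z, n, hn⟩
  unfold embed at hn
  split_ifs at hn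

theorem HH_le_const (hsub : SubStochastic K) (hl : l ≠ ⊤) {b : Conf V → ℝ≥0∞} {C : ℝ≥0∞}
    (hb : ∀ η, b η ≤ C) (η : Conf V) : HH K l b η ≤ C := by
  refine HH_le (g := fun _ => C) (fun η _ => hb η) (fun η h => ?_) η
  rw [LL_const hsub hl]

theorem delta_le_one (ξ : V → Bool) (η : Conf V) : delta ξ η ≤ 1 := by
  unfold delta; split_ifs <;> simp

theorem kernel_eq (hsub : SubStochastic K) (lam : ℝ) (ξ : V → Bool) (η : Conf V) :
    ⨆ t, kernelPow (toppleKernel K lam) t η (embed ξ) = HH K (ENNReal.ofReal lam) (delta ξ) η := by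
  set l := ENNReal.ofReal lam with hldef
  have hl : l ≠ ⊤ := ENNReal.ofReal_ne_top
  set kp : ℕ → Conf V → ℝ≥0∞ := fun t η => kernelPow (toppleKernel K lam) t η (embed ξ) with hkp
  have kp0 : ∀ η, kp 0 η = delta ξ η := fun η => rfl
  have kps : ∀ t η, ¬ Unst η → kp (t+1) η = kp t η := fun t η h =>
    tsum_topple_stable lam η (kp t) h
  have kpu : ∀ t η (h : Unst η), kp (t+1) η =
      if η (Exists.choose h) = Site.active 0 then LL K l (Exists.choose h) (kp t) η
      else MV K (Exists.choose h) (kp t) η := fun t η h => tsum_topple lam η (kp t) h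
  have kpst : ∀ t η, ¬ Unst η → kp t η = delta ξ η := by
    intro t η h
    induction t with
    | zero => exact kp0 η
    | succ t ih => rw [kps t η h, ih]
  have dun : ∀ η, Unst η → delta ξ η = 0 := by
    intro η h
    unfold delta
    rw [if_neg]
    rintro rfl
    exact embed_stable ξ h
  have kmono : ∀ t η, kp t η ≤ kp (t+1) η := by
    intro t
    induction t with
    | zero =>
      intro η
      by_cases h : Unst η
      · rw [kp0, dun η h]; exact zero_le
      · rw [kps 0 η h]
    | succ t ih =>
      intro η
      by_cases h : Unst η
      · rw [kpu _ _ h, kpu _ _ h]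
        split_ifs
        · exact LL_mono fun i => ih _
        · rw [MV_eq_LL, MV_eq_LL]; exact LL_mono fun i => ih _
      · rw [kpst _ η h, kpst _ η h]
  have kmono' : ∀ η, Monotone fun t => kp t η := fun η => monotone_nat_of_le_succ fun t => kmono t η
  show ⨆ t, kp t η = _
  apply le_antisymm
  · refine iSup_le fun t => ?_
    induction t generalizing η with
    | zero =>
      by_cases h : Unst η
      · rw [kp0, dun η h]; exact zero_le
      · rw [kp0, HH_stable h]
    | succ t ih =>
      by_cases h : Unst η
      · rw [kpu _ _ h]
        have ha := Unst.choose_act h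
        split_ifs with h0
        · rw [HH_harm (delta ξ) η _ ha]
          exact LL_mono fun i => ih _
        · obtain ⟨n, hn⟩ := ha
          cases n with
          | zero => exact absurd hn h0
          | succ n =>
            rw [(HH_harm (delta ξ)).mv hl hn (ne_top_of_le_ne_top ENNReal.one_ne_top
              (HH_le_const hsub hl (delta_le_one ξ) η)), MV_eq_LL, MV_eq_LL]
            exact LL_mono fun i => ih _
      · rw [kpst _ _ h, HH_stable h]
  · refine HH_le (g := fun η => ⨆ t, kp t η) (fun η h => ?_) (fun η h => ?_) η
    · rw [← kp0]; exact le_iSup (fun t => kp t η) 0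
    · have hS : (⨆ t, kp t η) = ⨆ t, kp (t+1) η := ((kmono' η).iSup_nat_add 1).symm
      by_cases h0 : η (Exists.choose h) = Site.active 0
      · rw [LL_iSup _ _ kmono', hS]
        simp only [kpu _ _ h, h0, if_true]
        exact le_rfl
      · obtain ⟨n, hn⟩ := Unst.choose_act h
        have hs : slpAt η (Exists.choose h) = η := by
          unfold slpAt opAt
          have : (η (Exists.choose h)).slp = η (Exists.choose h) := by
            cases n with
            | zero => exact absurd hn h0
            | succ n =>
              rw [hn]; rfl
          rw [this]; simp
        rw [LL_eq, hs, MV_eq_LL, LL_iSup _ _ kmono']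
        have : (⨆ n, LL K 0 (Exists.choose h) (kp n) η) = ⨆ t, kp t η := by
          rw [hS]
          simp only [kpu _ _ h, h0, if_false, MV_eq_LL]
        rw [this]
        show l * (l+1)⁻¹ * (⨆ t, kp t η) + _ ≤ _
        rw [← add_mul, pq hl, one_mul]

theorem tsum_list (f : List V → ℝ≥0∞) : ∑' w, f w = f [] + ∑ x, ∑' w, f (x :: w) := by
  rw [ENNReal.tsum_eq_add_tsum_ite ([] : List V)]
  congr 1
  have hinj : Function.Injective (fun p : V × List V => p.1 :: p.2) := by
    rintro ⟨a, b⟩ ⟨c, d⟩ h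
    simp only [List.cons.injEq] at h
    exact Prod.ext h.1 h.2
  rw [← tsum_fintype (L := .unconditional V)]
  rw [← ENNReal.tsum_prod (f := fun x w => f (x :: w))]
  have := hinj.tsum_eq (f := fun w => if w = [] then 0 else f w) (by
    intro w hw
    cases w with
    | nil => simp at hw
    | cons x w => exact ⟨(x, w), rfl⟩)
  refine Eq.trans (tsum_congr fun w => ?_) (this.symm.trans ?_)
  · cases w <;> simp
  · simp

noncomputable def EP (K : V → V → ℝ≥0∞) (x : V) (ψ : List V → ℝ≥0∞) : ℝ≥0∞ :=
  ∑' w, pathProb K x w * ψ w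

theorem EP_rec (x : V) (ψ : List V → ℝ≥0∞) :
    EP K x ψ = (∑ y, K x y * EP K y (fun w => ψ (y :: w))) + (1 - ∑ y, K x y) * ψ [] := by
  unfold EP
  rw [tsum_list, add_comm]
  congr 1
  refine Finset.sum_congr rfl fun y _ => ?_
  rw [← ENNReal.tsum_mul_left]
  exact tsum_congr fun w => by simp only [pathProb]; ring

theorem EP_le_one (hsub : SubStochastic K) (x : V) : EP K x (fun _ => 1) ≤ 1 := by
  have hm : ∀ N x, EP K x (fun w => if w.length < N then 1 else 0) ≤ 1 := by
    intro N
    induction N with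
    | zero => intro x; simp [EP]
    | succ N ih =>
      intro x
      rw [EP_rec]
      calc _ ≤ (∑ y, K x y * 1) + (1 - ∑ y, K x y) * 1 := by
            gcongr with y
            · simpa using ih y
            · simp
        _ = 1 := by simp only [mul_one]; exact add_tsub_cancel_of_le (hsub x)
  unfold EP
  rw [ENNReal.tsum_eq_iSup_sum]
  refine iSup_le fun s => ?_
  refine le_trans ?_ (hm (s.sup List.length + 1) x)
  refine le_trans ?_ (ENNReal.sum_le_tsum s)
  refine Finset.sum_le_sum fun w hw => ?_
  have : w.length < s.sup List.length + 1 := Nat.lt_succ_of_le (Finset.le_sup hw)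
  simp [this]

theorem EP_one (hsub : SubStochastic K) (hnd : NonDegenerate K) (x : V) :
    EP K x (fun _ => 1) = 1 := by
  refine congrFun (walk_uniq hsub hnd (fun x => EP K x (fun _ => 1)) (fun _ => 1)
    (fun x => 1 - ∑ y, K x y) (fun x => ne_top_of_le_ne_top ENNReal.one_ne_top (EP_le_one hsub x))
    (fun _ => ENNReal.one_ne_top) (fun x => Or.inr ⟨?_, ?_⟩)) x
  · rw [EP_rec]; simp
  · simp only [mul_one]; exact (add_tsub_cancel_of_le (hsub x)).symm

theorem EP_const (hsub : SubStochastic K) (hnd : NonDegenerate K) (x : V) (c : ℝ≥0∞) :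
    EP K x (fun _ => c) = c := by
  have := EP_one hsub hnd x
  unfold EP at *
  rw [ENNReal.tsum_mul_right]
  simp only [mul_one] at this
  rw [this, one_mul]

theorem EP_mono (x : V) {ψ χ : List V → ℝ≥0∞} (h : ∀ w, ψ w ≤ χ w) : EP K x ψ ≤ EP K x χ :=
  ENNReal.tsum_le_tsum fun w => mul_le_mul_right (h w) _

def cfg (A : Finset V) (b : V → Bool) : Conf V := fun x =>
  if x ∈ A then (if b x then Site.active 1 else Site.active 0)
  else (if b x then Site.sleeping else Site.empty)

theorem cfg_act {A : Finset V} {b : V → Bool} {x : V} (hx : x ∈ A) : Act (cfg A b) x := by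
  unfold Act cfg
  rw [if_pos hx]
  split_ifs
  · exact ⟨1, rfl⟩
  · exact ⟨0, rfl⟩

theorem cfg_insert {A : Finset V} {b : V → Bool} {x : V} (hx : x ∉ A) :
    addAt (cfg A b) x = cfg (insert x A) b := by
  funext y
  unfold addAt opAt
  by_cases hy : y = x
  · subst hy
    rw [Function.update_self]
    unfold cfg
    rw [if_neg hx, if_pos (Finset.mem_insert_self _ _)]
    split_ifs <;> rfl
  · rw [Function.update_of_ne hy]
    unfold cfg
    simp [Finset.mem_insert, hy]

theorem rem_add {η : Conf V} {x : V} (h : η x ≠ Site.sleeping) : remAt (addAt η x) x = η := by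
  unfold remAt addAt opAt
  rw [Function.update_self, Function.update_idem]
  have : ((η x).addActive).removeOne = η x := by
    revert h
    cases η x with
    | empty => intro _; rfl
    | sleeping => intro h; exact absurd rfl h
    | active n => intro _; rfl
  rw [this]; simp

/-- adding a particle at an active site -/
theorem Harm.add_mv {F : Conf V → ℝ≥0∞} (hF : Harm K l F) (hl : l ≠ ⊤) {η : Conf V} {x : V}
    (hx : Act η x) (hfin : ∀ η, F η ≠ ⊤) :
    F (addAt η x) = (∑ y, K x y * F (addAt η y)) + (1 - ∑ y, K x y) * F η := by
  obtain ⟨n, hn⟩ := hx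
  have h1 : (addAt η x) x = Site.active (n+1) := by
    unfold addAt opAt; rw [Function.update_self, hn]; rfl
  rw [hF.mv hl h1 (hfin _)]
  unfold MV
  rw [rem_add (by rw [hn]; simp)]

theorem idla_walk (hsub : SubStochastic K) (hnd : NonDegenerate K) (hl : l ≠ ⊤)
    {F : Conf V → ℝ≥0∞} (hF : Harm K l F) {C : ℝ≥0∞} (hC : C ≠ ⊤) (hFC : ∀ η, F η ≤ C)
    (A : Finset V) (b : V → Bool) (x : V) :
    F (addAt (cfg A b) x) = EP K x (fun w => F (cfg (idlaUpdate A (x :: w)) b)) := by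
  have hfin : ∀ η, F η ≠ ⊤ := fun η => ne_top_of_le_ne_top hC (hFC η)
  refine congrFun (walk_uniq hsub hnd (fun x => F (addAt (cfg A b) x))
    (fun x => EP K x (fun w => F (cfg (idlaUpdate A (x :: w)) b)))
    (fun x => (1 - ∑ y, K x y) * F (cfg A b)) (fun x => hfin _) (fun x => ?_) (fun x => ?_)) x
  · refine ne_top_of_le_ne_top hC ?_
    rw [← EP_const hsub hnd x C]
    exact EP_mono x fun w => hFC _
  · by_cases hx : x ∈ A
    · right
      refine ⟨hF.add_mv hl (cfg_act hx) hfin, ?_⟩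
      simp only [idlaUpdate, hx, if_true]
      rw [EP_rec]
      rfl
    · left
      simp only [idlaUpdate, hx, if_false]
      rw [EP_const hsub hnd, cfg_insert hx]

noncomputable def AA (ν : V → ℝ≥0∞) (F : Conf V → ℝ≥0∞) : Conf V → ℝ≥0∞ :=
  fun η => ∑ x, ν x * F (addAt η x)

theorem AA_harm (ν : V → ℝ≥0∞) {F : Conf V → ℝ≥0∞} (hF : Harm K l F) : Harm K l (AA ν F) :=
  Harm.sum Finset.univ ν (fun x => hF.comp_add x)

theorem AA_le {ν : V → ℝ≥0∞} (hν : IsProbVec ν) {F : Conf V → ℝ≥0∞} {C : ℝ≥0∞}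
    (hFC : ∀ η, F η ≤ C) (η : Conf V) : AA ν F η ≤ C := by
  unfold AA
  calc _ ≤ ∑ x, ν x * C := by gcongr; exact hFC _
    _ = C := by rw [← Finset.sum_mul, hν, one_mul]

theorem AA_iter_harm (ν : V → ℝ≥0∞) {F : Conf V → ℝ≥0∞} (hF : Harm K l F) (t : ℕ) :
    Harm K l ((AA ν)^[t] F) := by
  induction t with
  | zero => exact hF
  | succ t ih => rw [Function.iterate_succ_apply']; exact AA_harm ν ih

theorem AA_iter_le {ν : V → ℝ≥0∞} (hν : IsProbVec ν) {F : Conf V → ℝ≥0∞} {C : ℝ≥0∞}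
    (hFC : ∀ η, F η ≤ C) (t : ℕ) (η : Conf V) : (AA ν)^[t] F η ≤ C := by
  induction t generalizing η with
  | zero => exact hFC η
  | succ t ih => rw [Function.iterate_succ_apply']; exact AA_le hν ih η

theorem tsum_walk (ν : V → ℝ≥0∞) (ψ : List V → ℝ≥0∞) :
    ∑' w, walkProb K ν w * ψ w = ∑ x, ν x * EP K x (fun w => ψ (x :: w)) := by
  rw [tsum_list]
  simp only [walkProb, zero_mul, zero_add]
  refine Finset.sum_congr rfl fun x _ => ?_
  unfold EP
  rw [← ENNReal.tsum_mul_left]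
  exact tsum_congr fun w => by ring

theorem tsum_walk_const (hsub : SubStochastic K) (hnd : NonDegenerate K) {ν : V → ℝ≥0∞}
    (hν : IsProbVec ν) (c : ℝ≥0∞) : ∑' w, walkProb K ν w * c = c := by
  rw [tsum_walk]
  simp only [EP_const hsub hnd]
  rw [← Finset.sum_mul, hν, one_mul]

theorem AA_cfg (hsub : SubStochastic K) (hnd : NonDegenerate K) (hl : l ≠ ⊤) (ν : V → ℝ≥0∞)
    {F : Conf V → ℝ≥0∞} (hF : Harm K l F) {C : ℝ≥0∞} (hC : C ≠ ⊤) (hFC : ∀ η, F η ≤ C)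
    (A : Finset V) (b : V → Bool) :
    AA ν F (cfg A b) = ∑' w, walkProb K ν w * F (cfg (idlaUpdate A w) b) := by
  rw [tsum_walk]
  unfold AA
  refine Finset.sum_congr rfl fun x _ => ?_
  rw [idla_walk hsub hnd hl hF hC hFC]

noncomputable def WW (K : V → V → ℝ≥0∞) (ν : V → ℝ≥0∞) (t : ℕ) (Ψ : Finset V → ℝ≥0∞)
    (A : Finset V) : ℝ≥0∞ :=
  ∑' ws : Fin t → List V, (∏ i, walkProb K ν (ws i)) * Ψ (idlaSet A (List.ofFn ws))

theorem WW_zero (ν : V → ℝ≥0∞) (Ψ : Finset V → ℝ≥0∞) (A : Finset V) :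
    WW K ν 0 Ψ A = Ψ A := by
  unfold WW
  rw [tsum_fintype]
  simp [idlaSet]

theorem WW_succ (ν : V → ℝ≥0∞) (t : ℕ) (Ψ : Finset V → ℝ≥0∞) (A : Finset V) :
    WW K ν (t+1) Ψ A = ∑' w, walkProb K ν w * WW K ν t Ψ (idlaUpdate A w) := by
  unfold WW
  rw [← (Fin.consEquiv (fun _ : Fin (t+1) => List V)).tsum_eq, ENNReal.tsum_prod']
  refine tsum_congr fun w => ?_
  rw [← ENNReal.tsum_mul_left]
  refine tsum_congr fun ws => ?_
  simp only [Fin.consEquiv_apply, Fin.prod_univ_succ, Fin.cons_zero, Fin.cons_succ, List.ofFn_succ, idlaSet,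
    List.foldl_cons]
  ring

theorem AA_iter_cfg (hsub : SubStochastic K) (hnd : NonDegenerate K) (hl : l ≠ ⊤)
    {ν : V → ℝ≥0∞} (hν : IsProbVec ν)
    {F : Conf V → ℝ≥0∞} (hF : Harm K l F) {C : ℝ≥0∞} (hC : C ≠ ⊤) (hFC : ∀ η, F η ≤ C)
    (t : ℕ) (A : Finset V) (b : V → Bool) :
    (AA ν)^[t] F (cfg A b) = WW K ν t (fun S => F (cfg S b)) A := by
  induction t generalizing A with
  | zero => rw [WW_zero]; rfl
  | succ t ih =>
    rw [Function.iterate_succ_apply', WW_succ,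
      AA_cfg hsub hnd hl ν (AA_iter_harm ν hF t) hC (AA_iter_le hν hFC t)]
    simp only [ih]

theorem Harm.add_full (hsub : SubStochastic K) (hnd : NonDegenerate K) (hl : l ≠ ⊤)
    {F : Conf V → ℝ≥0∞} (hF : Harm K l F) (hfin : ∀ η, F η ≠ ⊤) {η : Conf V}
    (hη : ∀ x, Act η x) (x : V) : F (addAt η x) = F η := by
  refine congrFun (walk_uniq hsub hnd (fun x => F (addAt η x)) (fun _ => F η)
    (fun x => (1 - ∑ y, K x y) * F η) (fun x => hfin _) (fun x => hfin _)
    (fun x => Or.inr ⟨hF.add_mv hl (hη x) hfin, ?_⟩)) x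
  rw [← Finset.sum_mul, ← add_mul, add_tsub_cancel_of_le (hsub x), one_mul]

def oneC : Conf V := fun _ => Site.active 0

theorem Harm.full_eq (hsub : SubStochastic K) (hnd : NonDegenerate K) (hl : l ≠ ⊤)
    {F : Conf V → ℝ≥0∞} (hF : Harm K l F) (hfin : ∀ η, F η ≠ ⊤) (b : V → Bool) :
    F (cfg Finset.univ b) = F oneC := by
  have key : ∀ B : Finset V, F (fun x => if x ∈ B then Site.active 1 else Site.active 0) = F oneC := by
    intro B
    induction B using Finset.induction_on with
    | empty => simp; rfl
    | insert x B hx ih =>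
      rw [← ih, ← hF.add_full hsub hnd hl hfin
        (η := fun x => if x ∈ B then Site.active 1 else Site.active 0) _ x]
      · congr 1
        funext y
        unfold addAt opAt
        by_cases hy : y = x
        · subst hy; simp [hx, Site.addActive]
        · simp [hy]
      · intro y
        unfold Act
        simp only
        split_ifs
        · exact ⟨1, rfl⟩
        · exact ⟨0, rfl⟩
  rw [← key (Finset.univ.filter fun x => b x = true)]
  congr 1
  funext x
  simp [cfg]

def cnt (_ : V) : Site → ℕ
  | .empty => 0
  | .sleeping => 1
  | .active n => n+1

theorem cnt_act {η : Conf V} {z : V} (hz : Act η z) (i : Option (Option V)) :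
    tot cnt (act z i η) ≤ tot cnt η := by
  obtain ⟨n, hn⟩ := hz
  have hr : tot cnt (remAt η z) + 1 = tot cnt η := by
    have h := tot_op cnt Site.removeOne η z
    rw [hn] at h
    have e : cnt z (Site.active n) = cnt z (Site.active n).removeOne + 1 := by
      cases n <;> rfl
    rw [e] at h
    show tot cnt (opAt Site.removeOne η z) + 1 = _
    omega
  rcases i with _ | _ | y
  · have h := tot_op cnt Site.slp η z
    rw [hn] at h
    have e : cnt z (Site.active n) = cnt z (Site.active n).slp := by
      cases n <;> rfl
    show tot cnt (opAt Site.slp η z) ≤ _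
    omega
  · show tot cnt (remAt η z) ≤ _
    omega
  · have h := tot_op cnt Site.addActive (remAt η z) y
    have e : cnt y ((remAt η z y).addActive) = cnt y (remAt η z y) + 1 := by
      cases remAt η z y <;> rfl
    show tot cnt (opAt Site.addActive (remAt η z) y) ≤ _
    omega

theorem HH_full_zero (hsub : SubStochastic K) (hl : l ≠ ⊤) {η : Conf V}
    (h : tot cnt η < Fintype.card V) : HH K l (delta (fun _ => true)) η = 0 := by
  have : HH K l (delta (fun _ => true)) η ≤ (fun η : Conf V => if tot cnt η < Fintype.card V then 0 else 1) η := by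
    apply HH_le
    · intro η _
      split_ifs with h
      · unfold delta
        rw [if_neg]
        rintro rfl
        simp [tot, embed, cnt] at h
      · exact delta_le_one _ _
    · intro η hu
      split_ifs with h
      · have : LL K l (Exists.choose hu) (fun η : Conf V => if tot cnt η < Fintype.card V then 0 else 1) η
          = LL K l (Exists.choose hu) (fun _ => 0) η :=
          LL_congr fun i => if_pos (lt_of_le_of_lt (cnt_act (Unst.choose_act hu) i) h)
        rw [this, LL_const hsub hl]
      · refine (LL_mono (G := fun _ => 1) fun i => ?_).trans (LL_const hsub hl _ _ _).le
        split_ifs <;> simp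
  simpa [h] using this

theorem tot_cfg (S : Finset V) : tot cnt (cfg S (fun _ => false)) = S.card := by
  have : ∀ x, cnt x (cfg S (fun _ => false) x) = if x ∈ S then 1 else 0 := by
    intro x
    unfold cfg
    split_ifs <;> simp_all [cnt]
  unfold tot
  simp [this]

theorem stable_embed {η : Conf V} (h : ¬ Unst η) : ∃ ξ, embed ξ = η := by
  refine ⟨fun x => decide (η x = Site.sleeping), ?_⟩
  rw [unst_iff] at h
  push Not at h
  funext x
  have hx : ¬ ∃ n, η x = Site.active n := h x
  show (if decide (η x = Site.sleeping) = true then Site.sleeping else Site.empty) = η x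
  cases h' : η x with
  | empty => simp
  | sleeping => simp
  | active n => exact absurd ⟨n, h'⟩ hx

theorem embed_inj {ξ ζ : V → Bool} (h : embed ξ = embed ζ) : ξ = ζ := by
  funext x
  have := congrFun h x
  unfold embed at this
  revert this
  cases ξ x <;> cases ζ x <;> simp

theorem rep (hsub : SubStochastic K) (hnd : NonDegenerate K) (hl : l ≠ ⊤)
    {F : Conf V → ℝ≥0∞} (hF : Harm K l F) {C : ℝ≥0∞} (hC : C ≠ ⊤) (hFC : ∀ η, F η ≤ C)
    (ζ : Conf V) : F ζ = ∑ ξ : V → Bool, F (embed ξ) * HH K l (delta ξ) ζ := by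
  rw [harm_unique hsub hnd hl hF hC hFC F (fun _ _ => rfl) ζ]
  refine (harm_unique hsub hnd hl (F := fun ζ => ∑ ξ : V → Bool, F (embed ξ) * HH K l (delta ξ) ζ)
    (Harm.sum _ _ fun ξ => HH_harm _) (C := ∑ ξ : V → Bool, C * 1) ?_ ?_ F ?_ ζ).symm
  · exact ENNReal.sum_ne_top.2 fun _ _ => by simpa using hC
  · intro η
    gcongr
    · exact hFC _
    · exact HH_le_const hsub hl (delta_le_one _) η
  · intro η h
    simp only [HH_stable h]
    obtain ⟨ξ, rfl⟩ := stable_embed h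
    rw [Finset.sum_eq_single ξ]
    · simp [delta]
    · intro ζ _ hne
      unfold delta
      rw [if_neg (fun h => hne (embed_inj h)), mul_zero]
    · simp

theorem arwStep_eq (hsub : SubStochastic K) (lam : ℝ) (ν : V → ℝ≥0∞) (η ξ : V → Bool) :
    arwStep K lam ν η ξ = AA ν (HH K (ENNReal.ofReal lam) (delta ξ)) (embed η) := by
  unfold arwStep AA
  simp only [kernel_eq hsub]
  rfl

theorem pow_eq (hsub : SubStochastic K) (hnd : NonDegenerate K) {ν : V → ℝ≥0∞} (hν : IsProbVec ν)
    (lam : ℝ) (t : ℕ) (η ξ : V → Bool) :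
    ((arwMatrix K lam ν) ^ t) η ξ
      = ((AA ν)^[t] (HH K (ENNReal.ofReal lam) (delta ξ)) (embed η)).toReal := by
  have hl : ENNReal.ofReal lam ≠ ⊤ := ENNReal.ofReal_ne_top
  have hH : ∀ ξ η, HH K (ENNReal.ofReal lam) (delta ξ) η ≤ 1 :=
    fun ξ => HH_le_const hsub hl (delta_le_one ξ)
  have hAf : ∀ t ξ η, (AA ν)^[t] (HH K (ENNReal.ofReal lam) (delta ξ)) η ≠ ⊤ := fun t ξ η =>
    ne_top_of_le_ne_top ENNReal.one_ne_top (AA_iter_le hν (hH ξ) t η)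
  induction t generalizing η with
  | zero =>
    simp only [pow_zero, Function.iterate_zero, id]
    rw [HH_stable (embed_stable η), Matrix.one_apply]
    unfold delta
    by_cases h : η = ξ
    · subst h; simp
    · rw [if_neg h, if_neg (fun h' => h (embed_inj h').symm)]; simp
  | succ t ih =>
    rw [pow_succ', Matrix.mul_apply, Function.iterate_succ_apply']
    simp only [ih]
    set F := (AA ν)^[t] (HH K (ENNReal.ofReal lam) (delta ξ)) with hFdef
    have hF : Harm K (ENNReal.ofReal lam) F := AA_iter_harm ν (HH_harm _) t
    have e : AA ν F (embed η) = ∑ ζ, arwStep K lam ν η ζ * F (embed ζ) := by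
      simp only [arwStep_eq hsub]
      unfold AA
      simp only [Finset.sum_mul]
      rw [Finset.sum_comm]
      refine Finset.sum_congr rfl fun x _ => ?_
      rw [rep hsub hnd hl hF ENNReal.one_ne_top (AA_iter_le hν (hH ξ) t) (addAt (embed η) x), Finset.mul_sum]
      exact Finset.sum_congr rfl fun ζ _ => by ring
    rw [e, ENNReal.toReal_sum]
    · refine Finset.sum_congr rfl fun ζ _ => ?_
      rw [ENNReal.toReal_mul]; rfl
    · intro ζ _
      refine ENNReal.mul_ne_top ?_ (hAf t ξ _)
      rw [arwStep_eq hsub]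
      exact hAf 1 ζ _

theorem WW_mono (ν : V → ℝ≥0∞) (t : ℕ) {Ψ X : Finset V → ℝ≥0∞} (h : ∀ S, Ψ S ≤ X S) (A : Finset V) :
    WW K ν t Ψ A ≤ WW K ν t X A :=
  ENNReal.tsum_le_tsum fun _ => mul_le_mul_right (h _) _

theorem WW_add (ν : V → ℝ≥0∞) (t : ℕ) (Ψ X : Finset V → ℝ≥0∞) (A : Finset V) :
    WW K ν t (fun S => Ψ S + X S) A = WW K ν t Ψ A + WW K ν t X A := by
  unfold WW
  rw [← ENNReal.tsum_add]
  simp only [mul_add]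

theorem WW_mul (ν : V → ℝ≥0∞) (t : ℕ) (Ψ : Finset V → ℝ≥0∞) (c : ℝ≥0∞) (A : Finset V) :
    WW K ν t (fun S => Ψ S * c) A = WW K ν t Ψ A * c := by
  unfold WW
  rw [← ENNReal.tsum_mul_right]
  simp only [mul_assoc]

theorem WW_one (hsub : SubStochastic K) (hnd : NonDegenerate K) {ν : V → ℝ≥0∞}
    (hν : IsProbVec ν) (t : ℕ) (A : Finset V) : WW K ν t (fun _ => 1) A = 1 := by
  induction t generalizing A with
  | zero => rw [WW_zero]
  | succ t ih =>
    rw [WW_succ]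
    simp only [ih]
    exact tsum_walk_const hsub hnd hν 1

theorem idlaUpdate_sub (A : Finset V) (w : List V) : A ⊆ idlaUpdate A w := by
  induction w with
  | nil => exact Finset.Subset.refl _
  | cons x w ih =>
    unfold idlaUpdate
    split_ifs
    · exact ih
    · exact Finset.subset_insert _ _

theorem idlaUpdate_card (A : Finset V) {x : V} (hx : x ∉ A) (w : List V) (hw : x ∈ w) :
    (idlaUpdate A w).card = A.card + 1 := by
  induction w with
  | nil => simp at hw
  | cons y w ih =>
    unfold idlaUpdate
    split_ifs with hy
    · apply ih
      rcases List.mem_cons.1 hw with h | h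
      · subst h; exact absurd hy hx
      · exact h
    · exact Finset.card_insert_of_notMem hy

def nf (S : Finset V) : ℝ≥0∞ := if S = Finset.univ then 0 else 1

theorem nf_le (S : Finset V) : nf S ≤ 1 := by unfold nf; split_ifs <;> simp

theorem WW_univ (hsub : SubStochastic K) (hnd : NonDegenerate K) {ν : V → ℝ≥0∞}
    (hν : IsProbVec ν) (t : ℕ) : WW K ν t nf Finset.univ = 0 := by
  induction t with
  | zero => rw [WW_zero]; simp [nf]
  | succ t ih =>
    rw [WW_succ]
    have : ∀ w : List V, idlaUpdate Finset.univ w = (Finset.univ : Finset V) := fun w =>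
      Finset.univ_subset_iff.1 (idlaUpdate_sub _ _)
    simp [this, ih]

theorem tail_bound (hsub : SubStochastic K) (hnd : NonDegenerate K) {ν : V → ℝ≥0∞}
    (hν : IsProbVec ν) (ε : ℝ≥0∞) (hε : ∀ x, ε ≤ hitProb K ν x) (t : ℕ) (A : Finset V) :
    t * (ε * WW K ν t nf A) ≤ (Aᶜ.card : ℝ≥0∞) := by
  induction t generalizing A with
  | zero => simp
  | succ t ih =>
    by_cases hA : A = Finset.univ
    · subst hA; rw [WW_univ hsub hnd hν]; simp
    · obtain ⟨x, hx⟩ : ∃ x, x ∉ A := by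
        by_contra h
        push Not at h
        exact hA (Finset.eq_univ_iff_forall.2 h)
      have h1 : (∑' w, walkProb K ν w * ((idlaUpdate A w)ᶜ.card : ℝ≥0∞)) + hitProb K ν x
          ≤ (Aᶜ.card : ℝ≥0∞) := by
        unfold hitProb
        rw [← ENNReal.tsum_add, ← tsum_walk_const hsub hnd hν (Aᶜ.card : ℝ≥0∞)]
        refine ENNReal.tsum_le_tsum fun w => ?_
        split_ifs with hw
        · have hc : (idlaUpdate A w)ᶜ.card + 1 = Aᶜ.card := by
            have e1 := idlaUpdate_card A hx w hw
            have e2 := Finset.card_compl_add_card A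
            have e3 := Finset.card_compl_add_card (idlaUpdate A w)
            omega
          rw [← hc]; push_cast; rw [mul_add, mul_one]
        · rw [add_zero]
          gcongr
          exact idlaUpdate_sub A w
      have h2 : (t : ℝ≥0∞) * (ε * WW K ν (t+1) nf A)
          ≤ ∑' w, walkProb K ν w * ((idlaUpdate A w)ᶜ.card : ℝ≥0∞) := by
        rw [WW_succ, ← ENNReal.tsum_mul_left, ← ENNReal.tsum_mul_left]
        refine ENNReal.tsum_le_tsum fun w => ?_
        calc _ = walkProb K ν w * (t * (ε * WW K ν t nf (idlaUpdate A w))) := by ring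
          _ ≤ _ := by gcongr; exact ih _
      have h3 : ε * WW K ν (t+1) nf A ≤ hitProb K ν x := by
        refine le_trans ?_ (hε x)
        refine mul_le_of_le_one_right' ?_
        rw [← WW_one hsub hnd hν (t+1) A]
        exact WW_mono ν _ nf_le A
      push_cast
      rw [add_mul, one_mul]
      exact (add_le_add h2 h3).trans h1

theorem tail_tendsto [Nonempty V] (hsub : SubStochastic K) (hnd : NonDegenerate K) {ν : V → ℝ≥0∞}
    (hν : IsProbVec ν) (hadm : Admissible K ν) :
    Tendsto (fun t => WW K ν t nf ∅) atTop (nhds 0) := by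
  obtain ⟨x0, -, hx0⟩ := Finset.exists_min_image Finset.univ (hitProb K ν) Finset.univ_nonempty
  set ε := min (hitProb K ν x0) 1
  have hε : ∀ x, ε ≤ hitProb K ν x := fun x => (min_le_left _ _).trans (hx0 x (Finset.mem_univ x))
  have hpos : 0 < ε := lt_min (hadm x0) one_pos
  have hfin : ε ≠ ⊤ := ne_top_of_le_ne_top ENNReal.one_ne_top (min_le_right _ _)
  have hb : ∀ t : ℕ, WW K ν t nf ∅ ≤ (Fintype.card V : ℝ≥0∞) * ε⁻¹ * (t : ℝ≥0∞)⁻¹ := by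
    intro t
    have h := tail_bound hsub hnd hν ε hε t ∅
    simp only [Finset.compl_empty, Finset.card_univ] at h
    by_cases ht : t = 0
    · subst ht
      simp [ENNReal.mul_top, hfin]
    · rw [← div_eq_mul_inv, ENNReal.le_div_iff_mul_le (Or.inl (by simpa using ht)) (Or.inl (by simp)),
        ← div_eq_mul_inv, ENNReal.le_div_iff_mul_le (Or.inl hpos.ne') (Or.inl hfin)]
      refine le_trans (le_of_eq ?_) h
      ring
  refine tendsto_of_tendsto_of_tendsto_of_le_of_le tendsto_const_nhds ?_ (fun _ => zero_le) hb
  have := ENNReal.Tendsto.const_mul (a := (Fintype.card V : ℝ≥0∞) * ε⁻¹)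
    ENNReal.tendsto_inv_nat_nhds_zero (Or.inr (ENNReal.mul_ne_top (by simp) (by simp [hpos.ne'])))
  simpa using this

theorem Harm.add_pos (hsub : SubStochastic K) (hnd : NonDegenerate K) (hl : l ≠ ⊤)
    {F : Conf V → ℝ≥0∞} (hF : Harm K l F) {η : Conf V} (hη : ∀ x, η x ≠ Site.sleeping)
    (h0 : F η ≠ 0) (x : V) : F (addAt η x) ≠ 0 := by
  intro hx
  obtain ⟨w, hw, hne⟩ := hnd (Finset.univ.filter fun y => F (addAt η y) = 0) ⟨x, by simpa using hx⟩
  apply hne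
  have hw0 : F (addAt η w) = 0 := by simpa using hw
  rw [hF _ w (act_add_self η w), LL_eq] at hw0
  have h1 := (add_eq_zero.1 hw0).2
  have h2 : MV K w F (addAt η w) = 0 := by
    rcases mul_eq_zero.1 h1 with h | h
    · simp [hl] at h
    · exact h
  unfold MV at h2
  rw [rem_add (hη w)] at h2
  obtain ⟨h3, h4⟩ := add_eq_zero.1 h2
  have h5 : 1 ≤ ∑ y, K w y := by
    rcases mul_eq_zero.1 h4 with h | h
    · exact tsub_eq_zero_iff_le.1 h
    · exact absurd h h0
  rw [Finset.sum_filter_of_ne]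
  · exact le_antisymm (hsub w) h5
  · intro y hy hK
    exact (mul_eq_zero.1 (Finset.sum_eq_zero_iff.1 h3 y hy)).resolve_left hK

theorem mu_pos (hsub : SubStochastic K) (hnd : NonDegenerate K) (hl : l ≠ ⊤) (hl0 : l ≠ 0)
    (ξ : V → Bool) : HH K l (delta ξ) oneC ≠ 0 := by
  set F := HH K l (delta ξ) with hFd
  have hF : Harm K l F := HH_harm _
  have h1 : ∀ B : Finset V, (∀ x ∈ B, ξ x = true) →
      F (fun x => if x ∈ B then Site.active 0 else embed ξ x) ≠ 0 := by
    intro B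
    induction B using Finset.induction_on with
    | empty =>
      intro _
      have e : F (embed ξ) = 1 := by
        rw [hFd, HH_stable (embed_stable ξ)]; simp [delta]
      simp only [Finset.notMem_empty, if_false]
      show F (embed ξ) ≠ 0
      rw [e]; exact one_ne_zero
    | insert x B hx ih =>
      intro hB
      have ih' := ih fun y hy => hB y (Finset.mem_insert_of_mem hy)
      intro h0
      rw [hF _ x ⟨0, by simp⟩, LL_eq] at h0
      have h2 := (add_eq_zero.1 h0).1
      have h3 : slpAt (fun y => if y ∈ insert x B then Site.active 0 else embed ξ y) x
        = fun y => if y ∈ B then Site.active 0 else embed ξ y := by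
        funext y
        unfold slpAt opAt
        by_cases hy : y = x
        · subst hy; simp [hx, embed, hB, Site.slp]
        · simp [hy]
      rw [h3] at h2
      rcases mul_eq_zero.1 h2 with h | h
      · rcases mul_eq_zero.1 h with h | h
        · exact hl0 h
        · simp [hl] at h
      · exact ih' h
  have h2 : ∀ B : Finset V, (∀ x ∈ B, ξ x = false) →
      F (fun x => if x ∈ B then Site.active 0 else if ξ x then Site.active 0 else Site.empty) ≠ 0 := by
    intro B
    induction B using Finset.induction_on with
    | empty =>
      intro _
      convert h1 (Finset.univ.filter fun x => ξ x = true) (by simp) using 2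
      funext x
      by_cases h : ξ x = true <;> simp [h, embed]
    | insert x B hx ih =>
      intro hB
      have ih' := ih fun y hy => hB y (Finset.mem_insert_of_mem hy)
      have := hF.add_pos hsub hnd hl (by
        intro y
        split_ifs <;> simp) ih' x
      convert this using 2
      funext y
      unfold addAt opAt
      by_cases hy : y = x
      · subst hy; simp [hx, hB, Site.addActive]
      · simp [hy]
  convert h2 (Finset.univ.filter fun x => ξ x = false) (by simp) using 2
  funext x
  by_cases h : ξ x = true <;> simp [h, oneC]

end Aux

theorem arw_sep_eq_idla_tail
    {V : Type} [Fintype V] [DecidableEq V] [Nonempty V]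
    (K : V → V → ℝ≥0∞) (hsub : SubStochastic K) (hnd : NonDegenerate K)
    (ν : V → ℝ≥0∞) (hν : IsProbVec ν) (hadm : Admissible K ν)
    (lam : ℝ) (hlam : 0 < lam)
    (π : (V → Bool) → ℝ) (hπ : IsStationary (arwMatrix K lam ν) π)
    (t : ℕ) :
    sepDist (arwMatrix K lam ν) π t = (idlaTail K ν (∅ : Finset V) t).toReal := by
  set P := arwMatrix K lam ν with hP
  set l := ENNReal.ofReal lam with hld
  have hl : l ≠ ⊤ := ENNReal.ofReal_ne_top
  have hl0 : l ≠ 0 := by simp [hld, hlam]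
  have hH : ∀ ξ η, HH K l (delta ξ) η ≤ 1 := fun ξ => HH_le_const hsub hl (delta_le_one ξ)
  have hHf : ∀ ξ η, HH K l (delta ξ) η ≠ ⊤ := fun ξ η =>
    ne_top_of_le_ne_top ENNReal.one_ne_top (hH ξ η)
  set R : ℕ → ℝ := fun t => (WW K ν t nf ∅).toReal with hR
  have hrw : ∀ t, WW K ν t nf ∅ ≠ ⊤ := fun t => ne_top_of_le_ne_top ENNReal.one_ne_top (by
    rw [← WW_one hsub hnd hν t ∅]; exact WW_mono ν t nf_le ∅)
  let fl : Finset V → ℝ≥0∞ := fun S => if S = Finset.univ then 1 else 0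
  have hsum : ∀ t, WW K ν t fl ∅ + WW K ν t nf ∅ = 1 := by
    intro t
    rw [← WW_add, ← WW_one hsub hnd hν t ∅]
    congr 1
    funext S
    simp only [fl, nf]
    split_ifs <;> simp
  have hfl : ∀ t, (WW K ν t fl ∅).toReal = 1 - R t := by
    intro t
    have h1 : WW K ν t fl ∅ ≠ ⊤ := ne_top_of_le_ne_top ENNReal.one_ne_top (by
      rw [← hsum t]; exact le_self_add)
    have := congrArg ENNReal.toReal (hsum t)
    rw [ENNReal.toReal_add h1 (hrw t)] at this
    simp only [ENNReal.toReal_one] at this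
    simp only [hR]; linarith
  set μ : (V → Bool) → ℝ := fun ξ => (HH K l (delta ξ) oneC).toReal with hμ
  have hμpos : ∀ ξ, 0 < μ ξ := fun ξ =>
    ENNReal.toReal_pos (mu_pos hsub hnd hl hl0 ξ) (hHf _ _)
  have hμsum : ∑ ξ, μ ξ = 1 := by
    have := rep hsub hnd hl (F := fun _ => 1) (fun η z _ => (LL_const hsub hl z 1 η).symm)
      ENNReal.one_ne_top (fun _ => le_rfl) oneC
    simp only [one_mul] at this
    rw [hμ]
    simp only
    rw [← ENNReal.toReal_sum fun ξ _ => hHf ξ _, ← this, ENNReal.toReal_one]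
  have hcfg : ∀ η : V → Bool, embed η = cfg ∅ η := by
    intro η; funext x; simp [cfg, embed]
  have hpow : ∀ t η ξ, (P ^ t) η ξ = (WW K ν t (fun S => HH K l (delta ξ) (cfg S η)) ∅).toReal := by
    intro t η ξ
    rw [hP, pow_eq hsub hnd hν, hcfg,
      AA_iter_cfg hsub hnd hl hν (HH_harm _) ENNReal.one_ne_top (hH ξ)]
  have hlow : ∀ t η ξ, (1 - R t) * μ ξ ≤ (P ^ t) η ξ := by
    intro t η ξ
    rw [hpow, ← hfl, hμ, ← ENNReal.toReal_mul, ← WW_mul]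
    refine ENNReal.toReal_mono ?_ (WW_mono ν t (fun S => ?_) ∅)
    · refine ne_top_of_le_ne_top ENNReal.one_ne_top ?_
      rw [← WW_one hsub hnd hν t ∅]; exact WW_mono ν t (fun S => hH _ _) ∅
    · simp only [fl]
      split_ifs with h
      · subst h
        rw [one_mul, (HH_harm (delta ξ)).full_eq hsub hnd hl (hHf ξ)]
      · simp
  have heq : (P ^ t) (fun _ => false) (fun _ => true) = (1 - R t) * μ (fun _ => true) := by
    rw [hpow, ← hfl, hμ, ← ENNReal.toReal_mul, ← WW_mul]
    congr 2
    funext S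
    simp only [fl]
    split_ifs with h
    · subst h
      rw [one_mul, (HH_harm _).full_eq hsub hnd hl (hHf _)]
    · rw [zero_mul]
      apply HH_full_zero hsub hl
      rw [tot_cfg]
      exact (Finset.card_lt_iff_ne_univ S).2 h
  obtain ⟨hπ0, hπ1, hπ2⟩ := hπ
  have hstat : ∀ t ξ, ∑ η, π η * (P ^ t) η ξ = π ξ := by
    intro t
    induction t with
    | zero => intro ξ; simp [Matrix.one_apply]
    | succ t ih =>
      intro ξ
      rw [pow_succ]
      simp only [Matrix.mul_apply, Finset.mul_sum]
      rw [Finset.sum_comm]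
      simp only [← mul_assoc, ← Finset.sum_mul, ih]
      exact hπ2 ξ
  have hπlow : ∀ t ξ, (1 - R t) * μ ξ ≤ π ξ := by
    intro t ξ
    rw [← hstat t ξ]
    calc (1 - R t) * μ ξ = ∑ η, π η * ((1 - R t) * μ ξ) := by rw [← Finset.sum_mul, hπ1, one_mul]
      _ ≤ _ := Finset.sum_le_sum fun η _ => mul_le_mul_of_nonneg_left (hlow t η ξ) (hπ0 η)
  have hRt : Tendsto R atTop (nhds 0) := by
    have := (ENNReal.tendsto_toReal ENNReal.zero_ne_top).comp (tail_tendsto hsub hnd hν hadm)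
    rw [ENNReal.toReal_zero] at this
    exact this
  have hπge : ∀ ξ, μ ξ ≤ π ξ := by
    intro ξ
    have h1 : Tendsto (fun t => (1 - R t) * μ ξ) atTop (nhds ((1 - 0) * μ ξ)) :=
      (hRt.const_sub 1).mul_const _
    have := le_of_tendsto' h1 (fun t => hπlow t ξ)
    simpa using this
  have hπμ : ∀ ξ, π ξ = μ ξ := by
    intro ξ
    have h1 : ∑ ξ, (π ξ - μ ξ) = 0 := by rw [Finset.sum_sub_distrib, hπ1, hμsum, sub_self]
    have h2 := (Finset.sum_eq_zero_iff_of_nonneg fun ξ _ => sub_nonneg.2 (hπge ξ)).1 h1 ξ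
      (Finset.mem_univ ξ)
    linarith
  have htail : (idlaTail K ν (∅ : Finset V) t).toReal = R t := rfl
  rw [htail]
  unfold sepDist
  apply le_antisymm
  · refine ciSup_le fun η => ciSup_le fun ξ => ?_
    rw [hπμ ξ]
    have := (le_div_iff₀ (hμpos ξ)).2 (hlow t η ξ)
    linarith
  · refine le_ciSup_of_le (Set.finite_range _).bddAbove (fun _ => false) ?_
    refine le_ciSup_of_le (Set.finite_range _).bddAbove (fun _ => true) ?_
    rw [heq, hπμ, mul_div_cancel_right₀ _ (hμpos _).ne']
    linarith

end ARW
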